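/- Let (W,S) be a Coxeter system with W finite, and let s_1, s_2, s_3 ∈ S be distinct with m(s_1,s_2) = m(s_2,s_3) = 3 and m(s_1,s_3) = 2. Let C_1, C_3 be left cosets of W_ŝ_1 and C_2, C_4 left cosets of W_ŝ_2, with C_1 ≠ C_3 and C_2 ≠ C_4, and with C_1 ∩ C_2, C_2 ∩ C_3 and C_3 ∩ C_4 all nonempty. Then s_3 ∉ Supp(Π_{C_1}(C_4)) or s_2 ∉ Supp(Π_{C_1}(C_4)). -/

import Mathlib

/-!
Some constructions attached to a Coxeter system `cs : CoxeterSystem M W`: the word distance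
`d(u,v) = ℓ(u⁻¹ v)`, distances between subsets, the nearest-point projection of one coset onto
another, and standard parabolic subgroups.
-/

open Pointwise

namespace CoxAux

variable {B : Type*} {W : Type*} [Group W] {M : CoxeterMatrix B}

/-- The distance `d(u,v) = ℓ(u⁻¹ v)` on `W` induced by the Coxeter length function. -/
noncomputable def dist (cs : CoxeterSystem M W) (u v : W) : ℕ :=
  cs.length (u⁻¹ * v)

/-- The distance between two subsets of `W`: the least distance between a point of `X` and a
point of `Y`. -/
noncomputable def setDist (cs : CoxeterSystem M W) (X Y : Set W) : ℕ :=
  sInf { n | ∃ x ∈ X, ∃ y ∈ Y, dist cs x y = n }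

/-- The projection `Π_C(C') = {x ∈ C : d(x, C') = d(C, C')}` of `C'` onto `C`. -/
noncomputable def projSet (cs : CoxeterSystem M W) (C C' : Set W) : Set W :=
  { x ∈ C | setDist cs {x} C' = setDist cs C C' }

/-- The standard parabolic subgroup `W_ŝ` generated by the simple reflections other than
`s`. -/
def parabHat (cs : CoxeterSystem M W) (s : B) : Subgroup W :=
  Subgroup.closure { w | ∃ t : B, t ≠ s ∧ w = cs.simple t }

/-- The support of a subset `X ⊆ W`: the set of `s ∈ S` such that some `u ∈ X` satisfies
`u s ∈ X`. -/
def supp (cs : CoxeterSystem M W) (X : Set W) : Set B :=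
  { s : B | ∃ u ∈ X, u * cs.simple s ∈ X }

end CoxAux

open CoxAux

namespace CoxAux

variable {B : Type*} {W : Type*} [Group W] {M : CoxeterMatrix B}

/-- Twice the bilinear form of the geometric representation, paired with the simple root `i`. -/
noncomputable def coroot (M : CoxeterMatrix B) (i : B) : Module.Dual ℝ (B →₀ ℝ) :=
  Finsupp.linearCombination ℝ fun j => -2 * Real.cos (Real.pi / M i j)

lemma coroot_single (i j : B) (c : ℝ) :
    coroot M i (Finsupp.single j c) = c * (-2 * Real.cos (Real.pi / M i j)) := by
  simp [coroot]

lemma coroot_self (i : B) : coroot M i (Finsupp.single i 1) = 2 := by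
  simp [coroot_single]

/-- The reflection in the simple root `i`. -/
noncomputable def rootReflection (M : CoxeterMatrix B) (i : B) : (B →₀ ℝ) ≃ₗ[ℝ] (B →₀ ℝ) :=
  Module.reflection (coroot_self (M := M) i)

lemma rootReflection_apply (i : B) (v : B →₀ ℝ) :
    rootReflection M i v = v - coroot M i v • Finsupp.single i 1 :=
  Module.reflection_apply _ _

lemma rootReflection_apply_of_ne {i j : B} (h : j ≠ i) (v : B →₀ ℝ) :
    rootReflection M i v j = v j := by
  simp [rootReflection_apply, h.symm]

/-- Two reflections whose axes make an angle `π / m` generate a dihedral group of order `2 * m`. -/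
lemma reflection_mul_reflection_pow_eq_one {V : Type*} [AddCommGroup V] [Module ℝ V] {x y : V}
    {f g : Module.Dual ℝ V} (hf : f x = 2) (hg : g y = 2) {m : ℕ} (hm : 2 ≤ m)
    (hfy : f y = -2 * Real.cos (Real.pi / m)) (hgx : g x = -2 * Real.cos (Real.pi / m)) :
    (Module.reflection hf * Module.reflection hg) ^ m = 1 := by
  ext1 v
  rw [Module.reflection_mul_reflection_pow_apply hf hg m v, hfy, hgx, LinearEquiv.coe_one, id]
  obtain rfl | hm2 := eq_or_ne m 2
  · norm_num
    abel
  have hm : 3 ≤ m := by omega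
  have hpos : (0 : ℝ) < m := by exact_mod_cast (by omega : 0 < m)
  set θ : ℝ := 2 * (Real.pi / m) with hθ
  have ht : (-2 * Real.cos (Real.pi / m)) * (-2 * Real.cos (Real.pi / m)) - 2
      = 2 * Real.cos θ := by
    rw [hθ, Real.cos_two_mul]; ring
  rw [ht]
  have hsin : Real.sin θ ≠ 0 := by
    refine (Real.sin_pos_of_pos_of_lt_pi (by positivity) ?_).ne'
    rw [hθ, ← mul_div_assoc, div_lt_iff₀ hpos, mul_comm]
    have : (3 : ℝ) ≤ m := by exact_mod_cast hm
    nlinarith [Real.pi_pos]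
  have hS (n : ℤ) := Polynomial.Chebyshev.S_two_mul_real_cos θ n
  have hmθ : m * θ = 2 * Real.pi := by rw [hθ]; field_simp
  obtain ⟨k, hk | hk⟩ : ∃ k, m = 2 * k ∨ m = 2 * k + 1 := ⟨m / 2, by omega⟩
  · have h0 : (Polynomial.Chebyshev.S ℝ (k - 1)).eval (2 * Real.cos θ) = 0 := by
      have h := hS (k - 1)
      have : ((k - 1 : ℤ) + 1 : ℝ) * θ = Real.pi := by
        rw [hk] at hmθ; push_cast at hmθ ⊢; linarith
      rw [this, Real.sin_pi] at h
      exact (mul_eq_zero.mp h).resolve_right hsin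
    have e1 : ((m : ℤ) - 2) / 2 = k - 1 := by omega
    have e2 : ((m : ℤ) - 1) / 2 = k - 1 := by omega
    rw [e1, e2, h0]
    simp
  · have h0 : (Polynomial.Chebyshev.S ℝ k).eval (2 * Real.cos θ)
        + (Polynomial.Chebyshev.S ℝ (k - 1)).eval (2 * Real.cos θ) = 0 := by
      have h := hS k
      have h' := hS (k - 1)
      have : ((k : ℤ) + 1 : ℝ) * θ = 2 * Real.pi - ((k - 1 : ℤ) + 1 : ℝ) * θ := by
        rw [hk] at hmθ; push_cast at hmθ ⊢; linarith
      rw [this, Real.sin_two_pi_sub, ← h'] at h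
      exact (mul_eq_zero.mp (by linear_combination h)).resolve_right hsin
    have e1 : ((m : ℤ) - 2) / 2 = k - 1 := by omega
    have e2 : ((m : ℤ) - 1) / 2 = k := by omega
    have e3 : ((m : ℤ) - 3) / 2 = k - 1 := by omega
    have e4 : (m : ℤ) / 2 = k := by omega
    rw [e1, e2, e3, e4, h0]
    simp

lemma isLiftable_rootReflection : M.IsLiftable (rootReflection M) := by
  intro i j
  by_cases hij : i = j
  · subst hij
    rw [M.diagonal, pow_one]
    refine LinearEquiv.ext fun v => ?_
    rw [LinearEquiv.mul_apply, LinearEquiv.coe_one, id]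
    exact Module.involutive_reflection (coroot_self (M := M) i) v
  obtain hm0 | hm0 := eq_or_ne (M i j) 0
  · rw [hm0, pow_zero]
  have hm1 : M i j ≠ 1 := M.off_diagonal i j hij
  exact reflection_mul_reflection_pow_eq_one _ _ (by omega)
    (by rw [coroot_single, one_mul]) (by rw [coroot_single, one_mul, M.symmetric])

/-- The geometric representation of a Coxeter group. -/
noncomputable def geomRep (cs : CoxeterSystem M W) : W →* (B →₀ ℝ) ≃ₗ[ℝ] (B →₀ ℝ) :=
  cs.lift ⟨rootReflection M, isLiftable_rootReflection⟩

lemma geomRep_simple (cs : CoxeterSystem M W) (i : B) :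
    geomRep cs (cs.simple i) = rootReflection M i :=
  cs.lift_apply_simple isLiftable_rootReflection i

lemma geomRep_apply_of_mem_parabHat (cs : CoxeterSystem M W) {s : B} {w : W}
    (hw : w ∈ parabHat cs s) (v : B →₀ ℝ) : geomRep cs w v s = v s := by
  induction hw using Subgroup.closure_induction generalizing v with
  | mem x hx =>
    obtain ⟨t, ht, rfl⟩ := hx
    rw [geomRep_simple, rootReflection_apply_of_ne ht.symm]
  | one => simp
  | mul x y _ _ hx hy => rw [map_mul, LinearEquiv.mul_apply, hx, hy]
  | inv x _ hx =>
    rw [← hx, ← LinearEquiv.mul_apply, ← map_mul, mul_inv_cancel, map_one, LinearEquiv.coe_one,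
      id]

lemma simple_notMem_parabHat (cs : CoxeterSystem M W) (s : B) :
    cs.simple s ∉ parabHat cs s := by
  intro h
  have := geomRep_apply_of_mem_parabHat cs h (Finsupp.single s 1)
  rw [geomRep_simple, rootReflection_apply, coroot_self] at this
  norm_num at this

lemma simple_mem_parabHat (cs : CoxeterSystem M W) {s t : B} (h : t ≠ s) :
    cs.simple t ∈ parabHat cs s :=
  Subgroup.subset_closure ⟨t, h, rfl⟩

/-- The Coxeter graph: distinct vertices are joined when the simple reflections do not
commute. -/
def coxeterGraph (M : CoxeterMatrix B) : SimpleGraph B where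
  Adj i j := i ≠ j ∧ M i j ≠ 2
  symm := ⟨fun i j h => ⟨h.1.symm, M.symmetric i j ▸ h.2⟩⟩
  loopless := ⟨fun _ h => h.1 rfl⟩

lemma two_mul_cos_nonneg {i j : B} (h : i ≠ j) : 0 ≤ 2 * Real.cos (Real.pi / M i j) := by
  have := M.off_diagonal i j h
  obtain h0 | h0 := eq_or_ne (M i j) 0
  · simp [h0]
  have h2 : (2 : ℝ) ≤ M i j := by exact_mod_cast (by omega : 2 ≤ M i j)
  have : Real.pi / M i j ≤ Real.pi / 2 :=
    div_le_div_of_nonneg_left Real.pi_pos.le two_pos h2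
  have h3 : 0 ≤ Real.pi / M i j := by positivity
  exact mul_nonneg two_pos.le (Real.cos_nonneg_of_neg_pi_div_two_le_of_le (by linarith) this)

lemma one_le_two_mul_cos {i j : B} (h : (coxeterGraph M).Adj i j) :
    1 ≤ 2 * Real.cos (Real.pi / M i j) := by
  have := M.off_diagonal i j h.1
  have := h.2
  obtain h0 | h0 := eq_or_ne (M i j) 0
  · norm_num [h0]
  have h3 : (3 : ℝ) ≤ M i j := by exact_mod_cast (by omega : 3 ≤ M i j)
  have h4 : Real.pi / M i j ≤ Real.pi / 3 :=
    div_le_div_of_nonneg_left Real.pi_pos.le three_pos h3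
  have := Real.cos_le_cos_of_nonneg_of_le_pi (by positivity) (by linarith [Real.pi_pos]) h4
  rw [Real.cos_pi_div_three] at this
  linarith

lemma rootReflection_apply_self_ge {i j k : B} (hj : (coxeterGraph M).Adj i j)
    (hk : (coxeterGraph M).Adj i k) (hjk : j ≠ k) (v : B →₀ ℝ) (hv : ∀ b, 0 ≤ v b) :
    v j + v k - v i ≤ rootReflection M i v i := by
  classical
  have key : rootReflection M i v i
      = v i + ∑ b ∈ v.support, v b * (2 * Real.cos (Real.pi / M i b)) := by
    rw [rootReflection_apply, coroot, Finsupp.linearCombination_apply, Finsupp.sum]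
    simp only [Finsupp.sub_apply, Finsupp.smul_apply, Finsupp.single_eq_same, smul_eq_mul]
    rw [mul_one, sub_eq_add_neg, ← Finset.sum_neg_distrib]
    congr 1
    exact Finset.sum_congr rfl fun b _ => by ring
  have hsub : v.support ⊆ v.support ∪ {i, j, k} := Finset.subset_union_left
  have hsub' : ({i, j, k} : Finset B) ⊆ v.support ∪ {i, j, k} := Finset.subset_union_right
  rw [key, Finset.sum_subset hsub (fun b _ hb => by
    rw [Finsupp.notMem_support_iff.mp hb, zero_mul])]
  have hle : ∑ b ∈ {i, j, k}, v b * (2 * Real.cos (Real.pi / M i b))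
      ≤ ∑ b ∈ v.support ∪ {i, j, k}, v b * (2 * Real.cos (Real.pi / M i b)) := by
    refine Finset.sum_le_sum_of_subset_of_nonneg hsub' fun b _ hb => ?_
    have : i ≠ b := by rintro rfl; simp at hb
    exact mul_nonneg (hv b) (two_mul_cos_nonneg this)
  rw [Finset.sum_insert (by simp [hj.1, hk.1]), Finset.sum_pair hjk, M.diagonal] at hle
  have h1 := mul_le_mul_of_nonneg_left (one_le_two_mul_cos hj) (hv j)
  have h2 := mul_le_mul_of_nonneg_left (one_le_two_mul_cos hk) (hv k)
  simp only [Nat.cast_one, div_one, Real.cos_pi] at hle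
  linarith

lemma infinite_of_cyclic_adj (cs : CoxeterSystem M W) {n : ℕ} (hn : 3 ≤ n) (f : ℕ → B)
    (hf : ∀ k l, f k = f l ↔ k % n = l % n) (hadj : ∀ k, (coxeterGraph M).Adj (f k) (f (k + 1))) :
    Infinite W := by
  by_contra hfin
  rw [not_infinite_iff_finite] at hfin
  have hne : ∀ m t, 0 < t → t < n → f (m + t) ≠ f m := by
    intro m t h0 ht h
    rw [hf] at h
    have h' : t % n = 0 % n := Nat.ModEq.add_left_cancel' m h
    rw [Nat.mod_eq_of_lt ht, Nat.zero_mod] at h'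
    omega
  let v₀ : B →₀ ℝ := ∑ t ∈ Finset.range n, Finsupp.single (f t) (t : ℝ)
  have hv₀ : ∀ t < n, v₀ (f t) = t := by
    intro t ht
    simp only [v₀, Finsupp.finsetSum_apply]
    rw [Finset.sum_eq_single t]
    · simp
    · intro k hk hkt
      refine Finsupp.single_eq_of_ne' fun h => hkt ?_
      rwa [hf, Nat.mod_eq_of_lt (Finset.mem_range.mp hk), Nat.mod_eq_of_lt ht] at h
    · simp [ht]
  have hv₀_nonneg : ∀ b, 0 ≤ v₀ b := by
    intro b
    classical
    simp only [v₀, Finsupp.finsetSum_apply]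
    refine Finset.sum_nonneg fun t _ => ?_
    rw [Finsupp.single_apply]
    split_ifs <;> positivity
  let v : ℕ → B →₀ ℝ := fun m => Nat.rec v₀ (fun k x => rootReflection M (f k) x) m
  have hv_succ : ∀ m, v (m + 1) = rootReflection M (f m) (v m) := fun _ => rfl
  have hv_mem : ∀ m, ∃ w : W, v m = geomRep cs w v₀ := by
    intro m
    induction m with
    | zero => exact ⟨1, by rw [map_one, LinearEquiv.coe_one]; rfl⟩
    | succ m ih =>
      obtain ⟨w, hw⟩ := ih
      exact ⟨cs.simple (f m) * w, by
        rw [hv_succ, hw, map_mul, geomRep_simple, LinearEquiv.mul_apply]⟩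
  have hinv : ∀ m : ℕ, (∀ b, 0 ≤ v m b) ∧ (m : ℝ) ≤ v m (f m) ∧
      ∀ t, t + 1 < n → v m (f (m + t)) + 1 ≤ v m (f (m + t + 1)) := by
    intro m
    induction m with
    | zero =>
      refine ⟨hv₀_nonneg, by simpa using! hv₀_nonneg (f 0), fun t ht => ?_⟩
      change v₀ _ + 1 ≤ v₀ _
      rw [zero_add, hv₀ t (by omega), hv₀ (t + 1) ht]
      push_cast; rfl
    | succ m ih =>
      obtain ⟨hpos, hge, hstep⟩ := ih
      have hlast : f (m + (n - 2) + 1 + 1) = f m := by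
        rw [hf, show m + (n - 2) + 1 + 1 = m + n by omega, Nat.add_mod_right]
      have hother : ∀ t, 0 < t → t < n → v (m + 1) (f (m + t)) = v m (f (m + t)) := by
        intro t h0 ht
        rw [hv_succ, rootReflection_apply_of_ne (hne m t h0 ht)]
      have h1 := hstep 0 (by omega)
      rw [add_zero] at h1
      have hnew : v m (f (m + (n - 2) + 1)) + 1 ≤ v (m + 1) (f m) := by
        have hk := (hadj (m + (n - 2) + 1)).symm
        rw [hlast] at hk
        have hjk : f (m + 1) ≠ f (m + (n - 2) + 1) := by
          rw [add_right_comm]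
          exact (hne _ _ (by omega) (by omega)).symm
        have := rootReflection_apply_self_ge (hadj m) hk hjk (v m) hpos
        rw [← hv_succ] at this
        linarith
      refine ⟨fun b => ?_, ?_, fun t ht => ?_⟩
      · by_cases hb : b = f m
        · rw [hb]
          linarith [hpos (f (m + (n - 2) + 1))]
        · rw [hv_succ, rootReflection_apply_of_ne hb]
          exact hpos b
      · rw [hother 1 one_pos (by omega)]
        push_cast
        linarith
      · obtain ht' | ht' : t + 2 < n ∨ t = n - 2 := by omega
        · rw [show m + 1 + t = m + (t + 1) by omega, show m + (t + 1) + 1 = m + (t + 2) by omega,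
            hother _ (by omega) (by omega), hother _ (by omega) (by omega)]
          exact hstep (t + 1) (by omega)
        · rw [ht', show m + 1 + (n - 2) = m + (n - 1) by omega, hother _ (by omega) (by omega),
            show m + (n - 1) = m + (n - 2) + 1 by omega, hlast]
          exact hnew
  obtain ⟨C, hC⟩ := (Set.finite_range
    fun p : W × Fin n => geomRep cs p.1 v₀ (f p.2)).bddAbove
  obtain ⟨m, hm⟩ := exists_nat_gt C
  obtain ⟨w, hw⟩ := hv_mem m
  have hfm : f m = f (m % n) := by rw [hf, Nat.mod_mod]
  have h1 := hC ⟨(w, ⟨m % n, Nat.mod_lt _ (by omega)⟩), rfl⟩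
  have h2 := (hinv m).2.1
  rw [hw, hfm] at h2
  exact absurd (h2.trans h1) (not_le.mpr hm)

lemma isAcyclic_coxeterGraph (cs : CoxeterSystem M W) [Finite W] :
    (coxeterGraph M).IsAcyclic := by
  intro v c hc
  have hn := hc.three_le_length
  refine (infinite_of_cyclic_adj cs hn (fun k => c.getVert (k % c.length))
    (fun k l => ?_) (fun k => ?_)).not_finite ‹_›
  · have hlt (k : ℕ) : k % c.length < c.length := Nat.mod_lt _ (by omega)
    refine ⟨fun h => ?_, fun h => by simp only [h]⟩
    exact hc.getVert_injOn' (by simpa using Nat.le_sub_one_of_lt (hlt k))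
      (by simpa using Nat.le_sub_one_of_lt (hlt l)) h
  · have hlt : k % c.length < c.length := Nat.mod_lt _ (by omega)
    have hadj := c.adj_getVert_succ hlt
    have hmod : (k + 1) % c.length = (k % c.length + 1) % c.length := by simp
    simp only [hmod]
    obtain h | h : k % c.length + 1 < c.length ∨ k % c.length + 1 = c.length := by omega
    · rwa [Nat.mod_eq_of_lt h]
    · rw [h, c.getVert_length] at hadj
      rwa [h, Nat.mod_self, c.getVert_zero]

/-- The vertices which can be reached from `i` without passing through `j`. -/
def reachAvoiding (M : CoxeterMatrix B) (i j : B) : Set B :=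
  { k | ∃ p : (coxeterGraph M).Walk i k, j ∉ p.support }

lemma notMem_reachAvoiding (cs : CoxeterSystem M W) [Finite W] {i j k : B} (hik : i ≠ k)
    (hij : (coxeterGraph M).Adj i j) (hjk : (coxeterGraph M).Adj j k) :
    k ∉ reachAvoiding M i j := by
  classical
  rintro ⟨p, hp⟩
  let q : (coxeterGraph M).Walk i k := .cons hij (.cons hjk .nil)
  have hq : q.IsPath := by
    simp [q, SimpleGraph.Walk.isPath_def, hik, hij.ne, hjk.ne]
  have := ((isAcyclic_coxeterGraph cs).subsingleton_path i k).elim ⟨q, hq⟩ p.toPath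
  apply hp
  apply p.support_bypass_subset_support
  rw [show p.bypass = q from (congrArg Subtype.val this).symm]
  simp [q]

lemma simple_commute_of_notMem_reachAvoiding (cs : CoxeterSystem M W) {i j k l : B}
    (hk : k ∈ reachAvoiding M i j) (hl : l ∉ reachAvoiding M i j) (hlj : l ≠ j) :
    Commute (cs.simple l) (cs.simple k) := by
  obtain rfl | hlk := eq_or_ne l k
  · exact .refl _
  have h2 : M k l = 2 := by
    by_contra h
    obtain ⟨p, hp⟩ := hk
    have hadj : (coxeterGraph M).Adj k l := ⟨hlk.symm, h⟩
    refine hl ⟨p.concat hadj, ?_⟩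
    simp [SimpleGraph.Walk.support_concat, hp, hlj.symm]
  have h := cs.simple_mul_simple_pow k l
  rw [h2, pow_two, mul_eq_one_iff_eq_inv, mul_inv_rev, cs.inv_simple, cs.inv_simple] at h
  exact h.symm

open scoped Classical in
/-- One simple reflection acting on pairs of a group element and a parity: it conjugates the
element and changes the parity at the reflection itself. -/
noncomputable def reflectionStep (cs : CoxeterSystem M W) (i : B) :
    Function.End (W × ZMod 2) :=
  fun p => (cs.simple i * p.1 * cs.simple i, p.2 + if p.1 = cs.simple i then 1 else 0)

open scoped Classical in
lemma reflectionStep_mul_pow_apply (cs : CoxeterSystem M W) (i j : B) (k : ℕ) (t : W)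
    (ε : ZMod 2) :
    ((reflectionStep cs i * reflectionStep cs j) ^ k) (t, ε) =
      ((cs.simple i * cs.simple j) ^ k * t * ((cs.simple i * cs.simple j) ^ k)⁻¹,
        ε + ∑ l ∈ Finset.range (2 * k),
          if t = (cs.simple j * cs.simple i) ^ l * cs.simple j then 1 else 0) := by
  induction k with
  | zero => simp; rfl
  | succ k ih =>
    set r := cs.simple i * cs.simple j with hr
    set q := cs.simple j * cs.simple i with hq
    have hrq : r⁻¹ = q := by simp [hr, hq]
    have hqj : cs.simple j * r ^ k = q ^ k * cs.simple j := by
      have : cs.simple j * r * (cs.simple j)⁻¹ = q := by simp [hr, hq, mul_assoc]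
      rw [← this, conj_pow]
      simp
    have hpow : (r ^ k)⁻¹ = q ^ k := by rw [← inv_pow, hrq]
    have h1 : r ^ k * t * (r ^ k)⁻¹ = cs.simple j ↔ t = q ^ (2 * k) * cs.simple j := by
      rw [mul_inv_eq_iff_eq_mul, hqj, ← eq_inv_mul_iff_mul_eq, hpow, ← mul_assoc,
        ← pow_add, two_mul]
    have h2 : cs.simple j * (r ^ k * t * (r ^ k)⁻¹) * cs.simple j = cs.simple i ↔
        t = q ^ (2 * k + 1) * cs.simple j := by
      have hc : cs.simple j * (r ^ k * t * (r ^ k)⁻¹) * cs.simple j = cs.simple i ↔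
          r ^ k * t * (r ^ k)⁻¹ = q * cs.simple j := by
        constructor
        · intro h
          rw [hq, ← h]
          simp [mul_assoc]
        · intro h
          rw [h, hq]
          simp [mul_assoc]
      rw [hc, mul_inv_eq_iff_eq_mul, mul_assoc q, hqj, ← eq_inv_mul_iff_mul_eq, hpow,
        ← mul_assoc, ← mul_assoc, ← pow_succ, ← pow_add, show k + 1 + k = 2 * k + 1 by omega]
    rw [pow_succ']
    change reflectionStep cs i (reflectionStep cs j
      (((reflectionStep cs i * reflectionStep cs j) ^ k) (t, ε))) = _
    rw [ih, show 2 * (k + 1) = 2 * k + 1 + 1 by omega, Finset.sum_range_succ,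
      Finset.sum_range_succ]
    simp only [reflectionStep, h1, h2]
    refine Prod.ext ?_ ?_
    · simp [pow_succ', hr, mul_assoc]
    · simp only [add_assoc]

lemma isLiftable_reflectionStep (cs : CoxeterSystem M W) : M.IsLiftable (reflectionStep cs) := by
  classical
  intro i j
  funext p
  obtain ⟨t, ε⟩ := p
  rw [reflectionStep_mul_pow_apply, cs.simple_mul_simple_pow, two_mul, Finset.sum_range_add]
  simp only [pow_add, cs.simple_mul_simple_pow', one_mul, inv_one, mul_one,
    CharTwo.add_self_eq_zero, add_zero]
  rfl

/-- The permutation-style action of `W` recording parities of inversion counts. -/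
noncomputable def parityAction (cs : CoxeterSystem M W) : W →* Function.End (W × ZMod 2) :=
  cs.lift ⟨reflectionStep cs, isLiftable_reflectionStep cs⟩

lemma parityAction_simple (cs : CoxeterSystem M W) (i : B) :
    parityAction cs (cs.simple i) = reflectionStep cs i :=
  cs.lift_apply_simple (isLiftable_reflectionStep cs) i

lemma parityAction_mul_apply (cs : CoxeterSystem M W) (u w : W) (p : W × ZMod 2) :
    parityAction cs (u * w) p = parityAction cs u (parityAction cs w p) := by
  rw [map_mul]; rfl

open scoped Classical in
lemma parityAction_wordProd (cs : CoxeterSystem M W) (ω : List B) (t : W) (ε : ZMod 2) :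
    parityAction cs (cs.wordProd ω) (t, ε) =
      (cs.wordProd ω * t * (cs.wordProd ω)⁻¹, ε + (cs.rightInvSeq ω).count t) := by
  induction ω with
  | nil => simp; rfl
  | cons i ω ih =>
    rw [cs.wordProd_cons, parityAction_mul_apply, ih, parityAction_simple]
    refine Prod.ext ?_ ?_
    · simp [reflectionStep, mul_assoc]
    · have h : cs.wordProd ω * t * (cs.wordProd ω)⁻¹ = cs.simple i ↔
          (cs.wordProd ω)⁻¹ * cs.simple i * cs.wordProd ω = t := by
        constructor
        · rintro h; rw [← h]; group
        · rintro h; rw [← h]; group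
      simp [reflectionStep, CoxeterSystem.rightInvSeq, List.count_cons, h, add_assoc]

/-- The exchange condition. -/
lemma exists_mul_simple_eq_wordProd_eraseIdx (cs : CoxeterSystem M W) (ω : List B)
    {j : B} (h : cs.IsRightDescent (cs.wordProd ω) j) :
    ∃ k < ω.length, cs.wordProd ω * cs.simple j = cs.wordProd (ω.eraseIdx k) := by
  classical
  obtain ⟨ω', hω', hw⟩ := cs.exists_isReduced (cs.wordProd ω * cs.simple j)
  have hnot : cs.simple j ∉ cs.rightInvSeq ω' := fun hmem => by
    have := (cs.isRightInversion_of_mem_rightInvSeq hω' hmem).2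
    rw [← hw, cs.simple_mul_simple_cancel_right] at this
    exact lt_asymm this h
  have hmem : cs.simple j ∈ cs.rightInvSeq ω := by
    by_contra hn
    have h1 := parityAction_wordProd cs ω (cs.simple j) 0
    have h2 := parityAction_wordProd cs ω' (cs.simple j) 1
    rw [List.count_eq_zero_of_not_mem hn] at h1
    rw [List.count_eq_zero_of_not_mem hnot, ← hw, parityAction_mul_apply,
      parityAction_simple] at h2
    simp only [reflectionStep, cs.simple_mul_simple_self, one_mul, if_true,
      CharTwo.add_self_eq_zero] at h2
    rw [h1] at h2
    simpa using congrArg Prod.snd h2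
  obtain ⟨k, hk, hk'⟩ := List.mem_iff_getElem.mp hmem
  refine ⟨k, by simpa using hk, ?_⟩
  rw [← cs.wordProd_mul_getD_rightInvSeq, List.getD_eq_getElem _ _ hk, hk']

/-- The deletion condition. -/
lemma exists_isReduced_sublist (cs : CoxeterSystem M W) (ω : List B) :
    ∃ ω', ω'.Sublist ω ∧ cs.wordProd ω' = cs.wordProd ω ∧ cs.IsReduced ω' := by
  induction ω using List.reverseRecOn with
  | nil => exact ⟨[], List.Sublist.refl _, rfl, by simp [CoxeterSystem.IsReduced]⟩
  | append_singleton ω j ih =>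
    obtain ⟨ω', hsub, hprod, hred⟩ := ih
    have hωj : cs.wordProd (ω ++ [j]) = cs.wordProd ω' * cs.simple j := by
      rw [cs.wordProd_append, hprod, cs.wordProd_singleton]
    by_cases hd : cs.IsRightDescent (cs.wordProd ω') j
    · obtain ⟨k, hk, hk'⟩ := exists_mul_simple_eq_wordProd_eraseIdx cs ω' hd
      refine ⟨ω'.eraseIdx k, ((List.eraseIdx_sublist _ _).trans hsub).trans
        (List.sublist_append_left _ _), by rw [hωj, hk'], ?_⟩
      rw [cs.isRightDescent_iff, hk', hred.eq] at hd
      rw [CoxeterSystem.IsReduced, List.length_eraseIdx_of_lt hk]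
      omega
    · refine ⟨ω' ++ [j], hsub.append (List.Sublist.refl _), ?_, ?_⟩
      · rw [hωj, cs.wordProd_append, cs.wordProd_singleton]
      · rw [cs.not_isRightDescent_iff, hred.eq] at hd
        rw [CoxeterSystem.IsReduced, cs.wordProd_append, cs.wordProd_singleton, hd,
          List.length_append, List.length_singleton]

lemma exists_sublist_append (cs : CoxeterSystem M W) (ω₁ ω₂ : List B) :
    ∃ ω₁' ω₂', ω₁'.Sublist ω₁ ∧ ω₂'.Sublist ω₂ ∧
      cs.wordProd ω₁' * cs.wordProd ω₂' = cs.wordProd ω₁ * cs.wordProd ω₂ ∧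
      cs.length (cs.wordProd ω₁ * cs.wordProd ω₂) = ω₁'.length + ω₂'.length := by
  obtain ⟨ω', hsub, hprod, hred⟩ := exists_isReduced_sublist cs (ω₁ ++ ω₂)
  obtain ⟨ω₁', ω₂', rfl, h₁, h₂⟩ := List.sublist_append_iff.mp hsub
  rw [cs.wordProd_append, cs.wordProd_append] at hprod
  refine ⟨ω₁', ω₂', h₁, h₂, hprod, ?_⟩
  rw [← hprod, ← cs.wordProd_append, hred.eq, List.length_append]

lemma wordProd_mem_parabHat (cs : CoxeterSystem M W) {s : B} {ω : List B} (h : s ∉ ω) :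
    cs.wordProd ω ∈ parabHat cs s := by
  induction ω with
  | nil => exact cs.wordProd_nil ▸ one_mem _
  | cons i ω ih =>
    rw [List.mem_cons, not_or] at h
    exact cs.wordProd_cons i ω ▸ mul_mem (simple_mem_parabHat cs (Ne.symm h.1)) (ih h.2)

lemma exists_isReduced_notMem (cs : CoxeterSystem M W) {s : B} {w : W}
    (hw : w ∈ parabHat cs s) : ∃ ω, cs.IsReduced ω ∧ w = cs.wordProd ω ∧ s ∉ ω := by
  suffices ∃ ω, w = cs.wordProd ω ∧ s ∉ ω by
    obtain ⟨ω, rfl, hs⟩ := this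
    obtain ⟨ω', hsub, hprod, hred⟩ := exists_isReduced_sublist cs ω
    exact ⟨ω', hred, hprod.symm, fun h => hs (hsub.subset h)⟩
  induction hw using Subgroup.closure_induction with
  | mem x hx =>
    obtain ⟨t, ht, rfl⟩ := hx
    exact ⟨[t], by simp, by simpa using ht.symm⟩
  | one => exact ⟨[], by simp, by simp⟩
  | mul x y _ _ hx hy =>
    obtain ⟨ω, rfl, hω⟩ := hx
    obtain ⟨ω', rfl, hω'⟩ := hy
    exact ⟨ω ++ ω', (cs.wordProd_append _ _).symm, by simp [hω, hω']⟩
  | inv x _ hx =>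
    obtain ⟨ω, rfl, hω⟩ := hx
    exact ⟨ω.reverse, (cs.wordProd_reverse _).symm, by simpa using hω⟩

lemma length_mul_simple_of_mem_parabHat (cs : CoxeterSystem M W) {i : B} {w : W}
    (hw : w ∈ parabHat cs i) : cs.length (w * cs.simple i) = cs.length w + 1 := by
  rw [← cs.not_isRightDescent_iff]
  intro hd
  obtain ⟨ω, _, rfl, hi⟩ := exists_isReduced_notMem cs hw
  obtain ⟨k, _, hk⟩ := exists_mul_simple_eq_wordProd_eraseIdx cs ω hd
  refine simple_notMem_parabHat cs i ((Subgroup.mul_mem_cancel_left _ hw).mp ?_)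
  rw [hk]
  exact wordProd_mem_parabHat cs fun h => hi ((List.eraseIdx_sublist _ _).subset h)

lemma simple_braid (cs : CoxeterSystem M W) {i j : B} (h : M i j = 3) :
    cs.simple j * cs.simple i * cs.simple j = cs.simple i * cs.simple j * cs.simple i := by
  have := cs.simple_mul_simple_pow i j
  rw [h, pow_succ, pow_two, mul_eq_one_iff_eq_inv] at this
  rw [← mul_left_inj (cs.simple j), mul_assoc (cs.simple i * _), this]
  simp [mul_assoc]

lemma not_isRightDescent_mul_simple (cs : CoxeterSystem M W) {i j : B} (hij : M i j = 3) {w : W}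
    (hw : w ∈ parabHat cs i) :
    ¬ cs.IsRightDescent (w * cs.simple i) j := by
  intro hd
  have hji : j ≠ i := by rintro rfl; simp at hij
  have hne : cs.simple i ≠ cs.simple j := fun h =>
    simple_notMem_parabHat cs i (h ▸ simple_mem_parabHat cs hji)
  have hbraid := simple_braid cs hij
  obtain ⟨ω, hω, hwω, hi⟩ := exists_isReduced_notMem cs
    (mul_mem hw (simple_mem_parabHat cs hji))
  have hw' : w = cs.wordProd ω * cs.simple j := by
    rw [← hwω, cs.simple_mul_simple_cancel_right]
  have hword : w * cs.simple i = cs.wordProd (ω ++ [j, i]) := by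
    rw [hw', cs.wordProd_append, cs.wordProd_cons, cs.wordProd_singleton, mul_assoc]
  rw [hword] at hd
  obtain ⟨k, hk, hk'⟩ := exists_mul_simple_eq_wordProd_eraseIdx cs _ hd
  rw [cs.wordProd_append, cs.wordProd_cons, cs.wordProd_singleton, mul_assoc, hbraid] at hk'
  obtain hlt | rfl | rfl : k < ω.length ∨ k = ω.length ∨ k = ω.length + 1 := by
    simp at hk; omega
  · rw [List.eraseIdx_append_of_lt_length hlt, cs.wordProd_append, cs.wordProd_cons,
      cs.wordProd_singleton, mul_assoc, ← mul_assoc, mul_left_inj] at hk'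
    refine simple_notMem_parabHat cs i ((Subgroup.mul_mem_cancel_left _
      (wordProd_mem_parabHat cs hi)).mp (hk' ▸ wordProd_mem_parabHat cs fun h =>
        hi ((List.eraseIdx_sublist _ _).subset h)))
  · rw [List.eraseIdx_append_of_length_le le_rfl] at hk'
    simp only [Nat.sub_self, List.eraseIdx_cons_zero, cs.wordProd_append, cs.wordProd_singleton,
      mul_right_inj, mul_eq_right, mul_eq_one_iff_eq_inv, cs.inv_simple] at hk'
    exact hne hk'
  · rw [List.eraseIdx_append_of_length_le (by omega)] at hk'
    simp only [Nat.add_sub_cancel_left, List.eraseIdx_cons_succ, List.eraseIdx_cons_zero,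
      cs.wordProd_append, cs.wordProd_singleton, ← hbraid, mul_right_inj, mul_eq_right,
      mul_eq_one_iff_eq_inv, cs.inv_simple] at hk'
    exact hne hk'.symm

lemma not_isLeftDescent_simple_mul (cs : CoxeterSystem M W) {i j : B} (hij : M i j = 3) {w : W}
    (hw : w ∈ parabHat cs i) : ¬ cs.IsLeftDescent (cs.simple i * w) j := by
  rw [← cs.isRightDescent_inv_iff, mul_inv_rev, cs.inv_simple]
  exact not_isRightDescent_mul_simple cs hij (inv_mem hw)

/-- Lengths add along a coset of a parabolic subgroup, from a shortest element. -/
lemma length_mul_of_shortest (cs : CoxeterSystem M W) {i : B} {a z : W}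
    (ha : ∀ y ∈ parabHat cs i, cs.length a ≤ cs.length (a * y)) (hz : z ∈ parabHat cs i) :
    cs.length (a * z) = cs.length a + cs.length z := by
  obtain ⟨α, hα, rfl⟩ := cs.exists_isReduced a
  obtain ⟨ζ, hζ, rfl, hi⟩ := exists_isReduced_notMem cs hz
  obtain ⟨α', ζ', hα', hζ', hprod, hlen⟩ := exists_sublist_append cs α ζ
  have hmem : cs.wordProd ζ' ∈ parabHat cs i :=
    wordProd_mem_parabHat cs fun h => hi (hζ'.subset h)
  have h1 := ha _ (mul_mem hz (inv_mem hmem))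
  rw [← mul_assoc, ← hprod, mul_inv_cancel_right, hα.eq] at h1
  obtain rfl := hα'.eq_of_length_le (h1.trans (cs.length_wordProd_le _))
  rw [mul_right_inj] at hprod
  refine le_antisymm (cs.length_mul_le _ _) ?_
  rw [hlen, hα.eq, ← hprod]
  exact Nat.add_le_add_left (cs.length_wordProd_le _) _

lemma length_mul_of_shortest_left (cs : CoxeterSystem M W) {i : B} {a z : W}
    (ha : ∀ y ∈ parabHat cs i, cs.length a ≤ cs.length (y * a)) (hz : z ∈ parabHat cs i) :
    cs.length (z * a) = cs.length z + cs.length a := by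
  rw [← cs.length_inv, mul_inv_rev, length_mul_of_shortest cs _ (inv_mem hz), cs.length_inv,
    cs.length_inv, add_comm]
  intro y hy
  rw [← cs.length_inv (a⁻¹ * y), mul_inv_rev, inv_inv, cs.length_inv]
  exact ha _ (inv_mem hy)

lemma mul_mem_parabHat_of_shortest (cs : CoxeterSystem M W) {i j : B} {w z : W}
    (hw : w ∈ parabHat cs j) (hz : z ∈ parabHat cs i)
    (h : ∀ y ∈ parabHat cs i, cs.length (w * z) ≤ cs.length (w * z * y)) :
    w * z ∈ parabHat cs j := by
  obtain ⟨ω, -, rfl, hj⟩ := exists_isReduced_notMem cs hw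
  obtain ⟨ζ, -, rfl, hi⟩ := exists_isReduced_notMem cs hz
  obtain ⟨ω', ζ', hω', hζ', hprod, hlen⟩ := exists_sublist_append cs ω ζ
  have h1 := h (cs.wordProd ζ')⁻¹
    (inv_mem (wordProd_mem_parabHat cs fun h => hi (hζ'.subset h)))
  have h2 := cs.length_wordProd_le ω'
  rw [hlen, ← hprod, mul_inv_cancel_right] at h1
  obtain rfl : ζ' = [] := List.eq_nil_of_length_eq_zero (by omega)
  rw [← hprod, cs.wordProd_nil, mul_one]
  exact wordProd_mem_parabHat cs fun h => hj (hω'.subset h)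

lemma exists_shortest_mul (cs : CoxeterSystem M W) (i : B) {j : B} {w : W}
    (hw : w ∈ parabHat cs j) : ∃ a ∈ parabHat cs j, ∃ z ∈ parabHat cs i, w = a * z ∧
      ∀ y ∈ parabHat cs i, cs.length a ≤ cs.length (a * y) := by
  obtain ⟨z, hz, hmin⟩ := WellFounded.has_min (measure fun z => cs.length (w * z)).wf
    (parabHat cs i : Set W) ⟨1, one_mem _⟩
  have h : ∀ y ∈ parabHat cs i, cs.length (w * z) ≤ cs.length (w * z * y) := fun y hy => by
    rw [mul_assoc]
    exact not_lt.mp (hmin _ (mul_mem hz hy))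
  exact ⟨w * z, mul_mem_parabHat_of_shortest cs hw hz h, z⁻¹, inv_mem hz, by group, h⟩

lemma exists_mul_shortest (cs : CoxeterSystem M W) (i : B) {j : B} {w : W}
    (hw : w ∈ parabHat cs j) : ∃ z ∈ parabHat cs i, ∃ a ∈ parabHat cs j, w = z * a ∧
      ∀ y ∈ parabHat cs i, cs.length a ≤ cs.length (y * a) := by
  obtain ⟨a, ha, z, hz, h, hmin⟩ := exists_shortest_mul cs i (inv_mem hw)
  refine ⟨z⁻¹, inv_mem hz, a⁻¹, inv_mem ha, by rw [← mul_inv_rev, ← h, inv_inv], fun y hy => ?_⟩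
  rw [← cs.length_inv (y * a⁻¹), mul_inv_rev, inv_inv, cs.length_inv]
  exact hmin _ (inv_mem hy)

/-- A shortest element of a double coset of two maximal standard parabolic subgroups is
unique. -/
lemma eq_of_shortest_doubleCoset (cs : CoxeterSystem M W) {i j : B} {d p q : W}
    (hd : ∀ p ∈ parabHat cs i, ∀ q ∈ parabHat cs j, cs.length d ≤ cs.length (p * d * q))
    (hp : p ∈ parabHat cs i) (hq : q ∈ parabHat cs j)
    (h : cs.length (p * d * q) ≤ cs.length d) : p * d * q = d := by
  obtain ⟨δ, hδ, rfl⟩ := cs.exists_isReduced d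
  obtain ⟨π, -, rfl, hi⟩ := exists_isReduced_notMem cs hp
  obtain ⟨κ, -, rfl, hj⟩ := exists_isReduced_notMem cs hq
  obtain ⟨ω, hsub, hprod, hred⟩ := exists_isReduced_sublist cs (π ++ δ ++ κ)
  obtain ⟨ω', κ', rfl, h', hκ⟩ := List.sublist_append_iff.mp hsub
  obtain ⟨π', δ', rfl, hπ, hδ'⟩ := List.sublist_append_iff.mp h'
  have hlen := hred.eq
  simp only [cs.wordProd_append, List.length_append] at hprod hlen
  rw [hprod] at hlen
  have hp' := wordProd_mem_parabHat cs fun h => hi (hπ.subset h)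
  have hq' := wordProd_mem_parabHat cs fun h => hj (hκ.subset h)
  have h1 := hd _ (mul_mem (inv_mem hp') hp) _ (mul_mem hq (inv_mem hq'))
  have heq : (cs.wordProd π')⁻¹ * cs.wordProd π * cs.wordProd δ *
      (cs.wordProd κ * (cs.wordProd κ')⁻¹) = cs.wordProd δ' := by
    calc _ = (cs.wordProd π')⁻¹ * (cs.wordProd π * cs.wordProd δ * cs.wordProd κ) *
          (cs.wordProd κ')⁻¹ := by group
      _ = _ := by rw [← hprod]; group
  rw [heq] at h1
  have h2 := cs.length_wordProd_le δ'
  have h3 := hδ.eq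
  obtain rfl := hδ'.eq_of_length_le (by omega)
  obtain rfl : π' = [] := List.eq_nil_of_length_eq_zero (by omega)
  obtain rfl : κ' = [] := List.eq_nil_of_length_eq_zero (by omega)
  rw [← hprod, cs.wordProd_nil, one_mul, mul_one]

lemma exists_eq_mul_of_shortest_doubleCoset (cs : CoxeterSystem M W) {i j : B} {d p a b q : W}
    (hd : ∀ p ∈ parabHat cs i, ∀ q ∈ parabHat cs j, cs.length d ≤ cs.length (p * d * q))
    (hp : p ∈ parabHat cs i) (ha : a ∈ parabHat cs j) (hb : b ∈ parabHat cs i)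
    (hq : q ∈ parabHat cs j) (h : d = p * a * b * q) :
    ∃ a' ∈ parabHat cs j, ∃ b' ∈ parabHat cs i, d = a' * b' := by
  obtain ⟨π, -, rfl, hπi⟩ := exists_isReduced_notMem cs hp
  obtain ⟨α, -, rfl, hαj⟩ := exists_isReduced_notMem cs ha
  obtain ⟨β, -, rfl, hβi⟩ := exists_isReduced_notMem cs hb
  obtain ⟨κ, -, rfl, hκj⟩ := exists_isReduced_notMem cs hq
  obtain ⟨ω, hsub, hprod, hred⟩ := exists_isReduced_sublist cs (π ++ α ++ β ++ κ)
  obtain ⟨ω', κ', rfl, h', hκ⟩ := List.sublist_append_iff.mp hsub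
  obtain ⟨ω'', β', rfl, h'', hβ⟩ := List.sublist_append_iff.mp h'
  obtain ⟨π', α', rfl, hπ, hα⟩ := List.sublist_append_iff.mp h''
  have hlen := hred.eq
  simp only [cs.wordProd_append, List.length_append] at hprod hlen
  rw [← h] at hprod
  rw [hprod] at hlen
  have h1 := hd _ (inv_mem (wordProd_mem_parabHat cs fun h => hπi (hπ.subset h))) _
    (inv_mem (wordProd_mem_parabHat cs fun h => hκj (hκ.subset h)))
  have h2 := cs.length_wordProd_le (α' ++ β')
  have heq : (cs.wordProd π')⁻¹ * d * (cs.wordProd κ')⁻¹ = cs.wordProd (α' ++ β') := by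
    rw [← hprod, cs.wordProd_append]; group
  rw [heq] at h1
  rw [List.length_append] at h2
  obtain rfl : π' = [] := List.eq_nil_of_length_eq_zero (by omega)
  obtain rfl : κ' = [] := List.eq_nil_of_length_eq_zero (by omega)
  refine ⟨_, wordProd_mem_parabHat cs fun h => hαj (hα.subset h), _,
    wordProd_mem_parabHat cs fun h => hβi (hβ.subset h), ?_⟩
  simpa using hprod.symm

/-- If `i` is the only left descent of an element of `W_ĵ`, then the letters of its reduced words
lie in the component of `i` after deleting `j`. -/
lemma mem_reachAvoiding_of_forall_isLeftDescent (cs : CoxeterSystem M W) {i j : B}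
    (hij : i ≠ j) {ω : List B} (hω : cs.IsReduced ω) (hj : j ∉ ω)
    (hleft : ∀ x, cs.IsLeftDescent (cs.wordProd ω) x → x = i) :
    ∀ x ∈ ω, x ∈ reachAvoiding M i j := by
  have hi : i ∈ reachAvoiding M i j := ⟨.nil, by simpa using hij.symm⟩
  suffices ∀ β γ, ω = β ++ γ → ∀ x ∈ β, x ∈ reachAvoiding M i j from
    this ω [] (List.append_nil ω).symm
  intro β
  induction β using List.reverseRecOn with
  | nil => simp
  | append_singleton β x ih =>
    intro γ h
    have hβ := ih (x :: γ) (by simpa using h)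
    have hx : x ∈ reachAvoiding M i j := by
      by_contra hx
      have hxj : x ≠ j := by rintro rfl; simp [h] at hj
      have hcomm : Commute (cs.simple x) (cs.wordProd β) := by
        refine Commute.list_prod_right _ _ fun y hy => ?_
        obtain ⟨k, hk, rfl⟩ := List.mem_map.mp hy
        exact simple_commute_of_notMem_reachAvoiding cs (hβ k hk) hx hxj
      have heq : cs.simple x * cs.wordProd ω = cs.wordProd (β ++ γ) := by
        rw [h, cs.wordProd_append, cs.wordProd_append, cs.wordProd_append, cs.wordProd_singleton,
          ← hcomm.eq, mul_assoc, cs.simple_mul_simple_cancel_left]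
      refine hx (hleft x ?_ ▸ hi)
      have h1 := cs.length_wordProd_le (β ++ γ)
      have h2 := congrArg List.length h
      rw [CoxeterSystem.IsLeftDescent, heq, hω.eq]
      simp only [List.length_append, List.length_singleton] at h1 h2
      omega
    intro y hy
    rw [List.mem_append, List.mem_singleton] at hy
    rcases hy with hy | rfl
    exacts [hβ y hy, hx]

/-- If conjugation by a shortest coset representative turns a simple reflection into an element
of the parabolic subgroup, that element is a simple reflection. -/
lemma exists_eq_simple_of_simple_mul_eq (cs : CoxeterSystem M W) {i j : B} {d t : W}
    (hd : ∀ y ∈ parabHat cs j, cs.length d ≤ cs.length (d * y)) (ht : t ∈ parabHat cs j)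
    (h : cs.simple i * d = d * t) : ∃ k ≠ j, t = cs.simple k := by
  have h1 := length_mul_of_shortest cs hd ht
  have h2 := cs.length_mul_le (cs.simple i) d
  rw [← h] at h1
  rw [cs.length_simple] at h2
  have h3 : cs.length t ≠ 0 := fun h0 => by
    rw [cs.length_eq_zero_iff] at h0
    rw [h0, mul_one, mul_eq_right] at h
    simpa [h] using cs.length_simple i
  obtain ⟨k, rfl⟩ := cs.length_eq_one_iff.mp (show cs.length t = 1 by omega)
  exact ⟨k, fun hk => simple_notMem_parabHat cs j (hk ▸ ht), rfl⟩

lemma simple_mul_ne_of_shortest_doubleCoset (cs : CoxeterSystem M W) [Finite W] {s₁ s₂ s₃ : B}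
    (h12 : s₁ ≠ s₂) (h13 : s₁ ≠ s₃) (h23 : s₂ ≠ s₃) (m12 : M s₁ s₂ = 3) (m23 : M s₂ s₃ = 3)
    {a b t₂ t₃ : W} (ha : a ∈ parabHat cs s₂) (hb : b ∈ parabHat cs s₁)
    (hd : ∀ p ∈ parabHat cs s₁, ∀ q ∈ parabHat cs s₂,
      cs.length (a * b) ≤ cs.length (p * (a * b) * q))
    (ht₂ : t₂ ∈ parabHat cs s₂) (ht₃ : t₃ ∈ parabHat cs s₂)
    (h₂ : cs.simple s₂ * (a * b) = a * b * t₂) :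
    cs.simple s₃ * (a * b) ≠ a * b * t₃ := by
  intro h₃
  have m21 : M s₂ s₁ = 3 := M.symmetric s₁ s₂ ▸ m12
  have m32 : M s₃ s₂ = 3 := M.symmetric s₂ s₃ ▸ m23
  wlog hmin : ∀ z ∈ parabHat cs s₁, cs.length a ≤ cs.length (a * z) generalizing a b
  · obtain ⟨a', ha', z, hz, rfl, hmin'⟩ := exists_shortest_mul cs s₁ ha
    rw [mul_assoc a'] at hd h₂ h₃
    exact this ha' (mul_mem hz hb) hd h₂ h₃ hmin'
  have hdr : ∀ q ∈ parabHat cs s₂, cs.length (a * b) ≤ cs.length (a * b * q) := fun q hq => by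
    simpa using hd 1 (one_mem _) q hq
  have hdl : ∀ p ∈ parabHat cs s₁, cs.length (a * b) ≤ cs.length (p * (a * b)) := fun p hp => by
    simpa using hd p hp 1 (one_mem _)
  have hlen := length_mul_of_shortest cs hmin hb
  have hs12 := simple_mem_parabHat cs h12.symm
  have hs13 := simple_mem_parabHat cs h13.symm
  have hleft : ∀ x, cs.IsLeftDescent a x → x = s₁ := fun x hx => by
    by_contra hne
    have h1 := hdl _ (simple_mem_parabHat cs hne)
    have h2 := cs.length_mul_le (cs.simple x * a) b
    rw [mul_assoc] at h2
    rw [CoxeterSystem.IsLeftDescent] at hx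
    omega
  have hright : ∀ x, cs.IsRightDescent b x → x = s₂ := fun x hx => by
    by_contra hne
    have h1 := hdr _ (simple_mem_parabHat cs hne)
    have h2 := cs.length_mul_le a (b * cs.simple x)
    rw [← mul_assoc] at h2
    rw [CoxeterSystem.IsRightDescent] at hx
    omega
  have hab : a * b ≠ 1 := fun h => by
    rw [h, mul_one, one_mul] at h₂
    exact simple_notMem_parabHat cs s₂ (h₂ ▸ ht₂)
  have ha1 : a ≠ 1 := fun h => by
    subst h
    have h1 := hdl _ (inv_mem hb)
    rw [one_mul, inv_mul_cancel, cs.length_one, Nat.le_zero, cs.length_eq_zero_iff] at h1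
    exact hab (by rw [one_mul, h1])
  have hb1 : b ≠ 1 := fun h => by
    subst h
    have h1 := hdr _ (inv_mem ha)
    rw [mul_one, mul_inv_cancel, cs.length_one, Nat.le_zero, cs.length_eq_zero_iff] at h1
    exact hab (by rw [h1, mul_one])
  have has₁ : cs.length (cs.simple s₁ * a) < cs.length a := by
    obtain ⟨x, hx⟩ := cs.exists_leftDescent_of_ne_one ha1
    exact hleft x hx ▸ hx
  have hbs₂ : cs.length (b * cs.simple s₂) < cs.length b := by
    obtain ⟨x, hx⟩ := cs.exists_rightDescent_of_ne_one hb1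
    exact hright x hx ▸ hx
  obtain ⟨k, hk, rfl⟩ := exists_eq_simple_of_simple_mul_eq cs hdr ht₂ h₂
  obtain ⟨k', hk', rfl⟩ := exists_eq_simple_of_simple_mul_eq cs hdr ht₃ h₃
  -- `a` commutes with `s₃` and lies in `W_ŝ₃`
  obtain ⟨α, hα, hαa, hα₂⟩ := exists_isReduced_notMem cs ha
  have hmem := mem_reachAvoiding_of_forall_isLeftDescent cs h12 hα hα₂ (hαa ▸ hleft)
  have hs₃ : s₃ ∉ reachAvoiding M s₁ s₂ :=
    notMem_reachAvoiding cs h13 ⟨h12, by omega⟩ ⟨h23, by omega⟩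
  have ha₃ : a ∈ parabHat cs s₃ :=
    hαa ▸ wordProd_mem_parabHat cs fun h => hs₃ (hmem _ h)
  have hcomm : Commute (cs.simple s₃) a := by
    rw [hαa]
    refine Commute.list_prod_right _ _ fun y hy => ?_
    obtain ⟨x, hx, rfl⟩ := List.mem_map.mp hy
    exact simple_commute_of_notMem_reachAvoiding cs (hmem x hx) hs₃ h23.symm
  have hb₃ : cs.simple s₃ * b = b * cs.simple k' := by
    rwa [← mul_assoc, hcomm.eq, mul_assoc, mul_assoc, mul_right_inj] at h₃
  -- `k = s₁`
  obtain rfl : k = s₁ := by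
    by_contra hne
    have hz : b * cs.simple k * b⁻¹ ∈ parabHat cs s₁ :=
      mul_mem (mul_mem hb (simple_mem_parabHat cs hne)) (inv_mem hb)
    have heq : cs.simple s₂ * a = a * (b * cs.simple k * b⁻¹) := by
      rw [← mul_left_inj b, mul_assoc, h₂]; group
    have h1 := length_mul_of_shortest cs hmin hz
    have h2 := cs.length_mul_le (cs.simple s₁ * a) (b * cs.simple k * b⁻¹)
    refine not_isLeftDescent_simple_mul cs m21 ha (j := s₁) ?_
    rw [CoxeterSystem.IsLeftDescent, heq, ← mul_assoc]
    omega
  -- `b` lies in `W_ŝ₃`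
  obtain ⟨z, hz, b', hb', hbz, hmin'⟩ := exists_mul_shortest cs s₃ hb
  have hb₃' : b ∈ parabHat cs s₃ := by
    suffices b' = 1 by rwa [hbz, this, mul_one]
    by_contra hne
    have hlenb := length_mul_of_shortest_left cs hmin' hz
    have hbs₂' : cs.length (b' * cs.simple s₂) < cs.length b' := by
      obtain ⟨x, hx⟩ := cs.exists_rightDescent_of_ne_one hne
      suffices cs.IsRightDescent b x from hright x this ▸ hx
      have h2 := cs.length_mul_le z (b' * cs.simple x)
      rw [CoxeterSystem.IsRightDescent] at hx ⊢
      rw [hbz, mul_assoc]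
      omega
    have hy : z⁻¹ * (a⁻¹ * cs.simple s₂ * a) * z ∈ parabHat cs s₃ :=
      mul_mem (mul_mem (inv_mem hz) (mul_mem (mul_mem (inv_mem ha₃)
        (simple_mem_parabHat cs h23)) ha₃)) hz
    have heq : b' * cs.simple k = z⁻¹ * (a⁻¹ * cs.simple s₂ * a) * z * b' := by
      rw [mul_assoc _ z, ← hbz]
      have : cs.simple s₂ * a * b = a * b * cs.simple k := by rw [mul_assoc, h₂]
      calc b' * cs.simple k = z⁻¹ * (a⁻¹ * (a * (z * b') * cs.simple k)) := by group
        _ = _ := by rw [← hbz, ← this]; group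
    have h1 := length_mul_of_shortest_left cs hmin' hy
    have h2 := cs.length_mul_le (z⁻¹ * (a⁻¹ * cs.simple s₂ * a) * z) (b' * cs.simple s₂)
    refine not_isRightDescent_mul_simple cs m12 hb' (j := s₂) ?_
    rw [CoxeterSystem.IsRightDescent, heq, mul_assoc _ b']
    omega
  -- `k' = s₃`
  obtain rfl : k' = s₃ := by
    by_contra hne
    refine simple_notMem_parabHat cs s₃ ?_
    rw [eq_mul_inv_of_mul_eq hb₃]
    exact mul_mem (mul_mem hb₃' (simple_mem_parabHat cs hne)) (inv_mem hb₃')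
  refine not_isRightDescent_mul_simple cs m32 hb₃' (j := s₂) ?_
  have h1 := cs.length_mul_le (cs.simple k') (b * cs.simple s₂)
  rw [cs.length_simple, ← mul_assoc, hb₃] at h1
  rw [CoxeterSystem.IsRightDescent, length_mul_simple_of_mem_parabHat cs hb₃']
  omega

lemma exists_dist_le_of_mem_projSet (cs : CoxeterSystem M W) {C C' : Set W} {u : W}
    (hu : u ∈ projSet cs C C') (hC' : C'.Nonempty) :
    ∃ y ∈ C', ∀ x ∈ C, ∀ y' ∈ C', cs.length (u⁻¹ * y) ≤ cs.length (x⁻¹ * y') := by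
  obtain ⟨y₀, hy₀⟩ := hC'
  obtain ⟨x, hx, y, hy, h⟩ := Nat.sInf_mem
    (s := { n | ∃ x ∈ ({u} : Set W), ∃ y ∈ C', dist cs x y = n }) ⟨_, u, rfl, y₀, hy₀, rfl⟩
  obtain rfl : x = u := hx
  refine ⟨y, hy, fun x' hx' y' hy' => ?_⟩
  exact h.trans_le (hu.2.trans_le (Nat.sInf_le ⟨x', hx', y', hy', rfl⟩))

lemma inv_mul_mem_of_mem_smul {G : Type*} [Group G] {H : Subgroup G} {g u v : G}
    (hu : u ∈ g • (H : Set G)) (hv : v ∈ g • (H : Set G)) : u⁻¹ * v ∈ H := by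
  rw [mem_leftCoset_iff] at hu hv
  simpa [mul_assoc] using H.mul_mem (H.inv_mem hu) hv

lemma mul_mem_smul {G : Type*} [Group G] {H : Subgroup G} {g u h : G}
    (hu : u ∈ g • (H : Set G)) (hh : h ∈ H) : u * h ∈ g • (H : Set G) := by
  rw [mem_leftCoset_iff] at hu ⊢
  rw [← mul_assoc]
  exact H.mul_mem hu hh

lemma exists_simple_mul_eq_of_mem_supp_projSet (cs : CoxeterSystem M W) {i j s : B} {g g' : W}
    (hs : s ∈ supp cs (projSet cs (g • (parabHat cs i : Set W)) (g' • (parabHat cs j : Set W)))) :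
    ∃ u ∈ g • (parabHat cs i : Set W), ∃ y ∈ g' • (parabHat cs j : Set W),
      (∀ p ∈ parabHat cs i, ∀ q ∈ parabHat cs j,
        cs.length (u⁻¹ * y) ≤ cs.length (p * (u⁻¹ * y) * q)) ∧
      ∃ t ∈ parabHat cs j, cs.simple s * (u⁻¹ * y) = u⁻¹ * y * t := by
  obtain ⟨u, hu, hus⟩ := hs
  have hne : (g' • (parabHat cs j : Set W)).Nonempty := Set.Nonempty.smul_set ⟨1, one_mem _⟩
  obtain ⟨y, hy, hmin⟩ := exists_dist_le_of_mem_projSet cs hu hne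
  obtain ⟨y', hy', hmin'⟩ := exists_dist_le_of_mem_projSet cs hus hne
  have hd : ∀ p ∈ parabHat cs i, ∀ q ∈ parabHat cs j,
      cs.length (u⁻¹ * y) ≤ cs.length (p * (u⁻¹ * y) * q) := fun p hp q hq => by
    have := hmin _ (mul_mem_smul hu.1 (inv_mem hp)) _ (mul_mem_smul hy hq)
    rwa [mul_inv_rev, inv_inv, mul_assoc, ← mul_assoc u⁻¹, ← mul_assoc p] at this
  have hq : y⁻¹ * y' ∈ parabHat cs j := inv_mul_mem_of_mem_smul hy hy'
  have hp : cs.simple s ∈ parabHat cs i := by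
    simpa using inv_mul_mem_of_mem_smul hu.1 hus.1
  refine ⟨u, hu.1, y, hy, hd, (y⁻¹ * y')⁻¹, inv_mem hq, ?_⟩
  rw [eq_mul_inv_iff_mul_eq]
  refine eq_of_shortest_doubleCoset cs hd hp hq ?_
  have := hmin' u hu.1 y hy
  convert this using 2
  simp [mul_assoc]

end CoxAux

/-- Let `(W, S)` be a finite Coxeter system and `s₁, s₂, s₃ ∈ S` distinct with
`m(s₁,s₂) = m(s₂,s₃) = 3` and `m(s₁,s₃) = 2`. For distinct left cosets `C₁ ≠ C₃` of `W_ŝ₁`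
and distinct left cosets `C₂ ≠ C₄` of `W_ŝ₂` with `C₁ ∩ C₂`, `C₂ ∩ C₃` and `C₃ ∩ C₄`
nonempty, either `s₃ ∉ Supp(Π_{C₁}(C₄))` or `s₂ ∉ Supp(Π_{C₁}(C₄))`. -/
theorem supp_projSet_avoids {B : Type*} {W : Type*} [Group W] {M : CoxeterMatrix B}
    (cs : CoxeterSystem M W) [Finite W]
    (s₁ s₂ s₃ : B) (h12 : s₁ ≠ s₂) (h13 : s₁ ≠ s₃) (h23 : s₂ ≠ s₃)
    (m12 : M s₁ s₂ = 3) (m23 : M s₂ s₃ = 3) (m13 : M s₁ s₃ = 2)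
    (g₁ g₂ g₃ g₄ : W)
    (C₁ C₂ C₃ C₄ : Set W)
    (hC₁ : C₁ = g₁ • (parabHat cs s₁ : Set W)) (hC₃ : C₃ = g₃ • (parabHat cs s₁ : Set W))
    (hC₂ : C₂ = g₂ • (parabHat cs s₂ : Set W)) (hC₄ : C₄ = g₄ • (parabHat cs s₂ : Set W))
    (h13' : C₁ ≠ C₃) (h24' : C₂ ≠ C₄)
    (e12 : (C₁ ∩ C₂).Nonempty) (e23 : (C₂ ∩ C₃).Nonempty) (e34 : (C₃ ∩ C₄).Nonempty) :
    s₃ ∉ supp cs (projSet cs C₁ C₄) ∨ s₂ ∉ supp cs (projSet cs C₁ C₄) := by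
  subst hC₁ hC₂ hC₃ hC₄
  by_contra! h
  obtain ⟨hs₃, hs₂⟩ := h
  obtain ⟨u, hu, y, hy, hd, t₂, ht₂, h₂⟩ := exists_simple_mul_eq_of_mem_supp_projSet cs hs₂
  obtain ⟨u', hu', y', hy', hd', t₃, ht₃, h₃⟩ := exists_simple_mul_eq_of_mem_supp_projSet cs hs₃
  obtain ⟨c₁₂, h1, h2⟩ := e12
  obtain ⟨c₂₃, h2', h3⟩ := e23
  obtain ⟨c₃₄, h3', h4⟩ := e34
  have hd_eq : u'⁻¹ * y' = u⁻¹ * y := by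
    have hp := inv_mul_mem_of_mem_smul hu' hu
    have hq := inv_mul_mem_of_mem_smul hy hy'
    have heq : u'⁻¹ * u * (u⁻¹ * y) * (y⁻¹ * y') = u'⁻¹ * y' := by group
    rw [← heq]
    refine eq_of_shortest_doubleCoset cs hd hp hq ?_
    rw [heq]
    convert hd' _ (inv_mem hp) _ (inv_mem hq) using 2
    group
  rw [hd_eq] at h₃
  obtain ⟨a, ha, b, hb, hab⟩ := exists_eq_mul_of_shortest_doubleCoset cs hd
    (inv_mul_mem_of_mem_smul hu h1) (inv_mul_mem_of_mem_smul h2 h2')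
    (inv_mul_mem_of_mem_smul h3 h3') (inv_mul_mem_of_mem_smul h4 hy) (by group)
  rw [hab] at hd h₂ h₃
  exact simple_mul_ne_of_shortest_doubleCoset cs h12 h13 h23 m12 m23 ha hb hd ht₂ ht₃ h₂ h₃
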